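/- Let $f : \mathbb{C}^m \to \mathbb{C}$ be a holomorphic function with $f(z)e^{-\pi|z|^2/2} \in L^2(\mathbb{C}^m)$. Among all holomorphic functions $F : \mathbb{C}^n \to \mathbb{C}$ with $F(z)e^{-\pi|z|^2/2} \in L^2(\mathbb{C}^n)$ and $F|_{\mathbb{C}^m} = f$ (where $\mathbb{C}^m = \{z_{m+1}=\cdots=z_n=0\}$), the one of minimal weighted $L^2$-norm is $F(z_1,\dots,z_n) = f(z_1,\dots,z_m)$, and its norm satisfies $\int_{\mathbb{C}^n} |F|^2 e^{-\pi|z|^2} dV = \int_{\mathbb{C}^m} |f|^2 e^{-\pi|z|^2} dV$. -/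

import Mathlib

open MeasureTheory

/-- The sub-mean value inequality for `‖g‖²` over the orbit of `z` under scalar rotations. -/
theorem enorm_sq_mul_two_pi_le_lintegral_rotation {E : Type*} [NormedAddCommGroup E]
    [NormedSpace ℂ E] {g : E → ℂ} (hg : Differentiable ℂ g) (z : E) :
    ‖g 0‖ₑ ^ 2 * ENNReal.ofReal (2 * Real.pi) ≤
      ∫⁻ θ in Set.Ioc 0 (2 * Real.pi), ‖g (circleMap 0 1 θ • z)‖ₑ ^ 2 := by
  have hmean : Real.circleAverage (fun t : ℂ => g (t • z) ^ 2) 0 1 = g 0 ^ 2 := by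
    have hd : Differentiable ℂ fun t : ℂ => g (t • z) ^ 2 :=
      (hg.comp (differentiable_id.smul_const z)).pow 2
    simpa using hd.diffContOnCl.circleAverage (c := 0) (R := 1)
  rw [Real.circleAverage_def, intervalIntegral.integral_of_le Real.two_pi_pos.le] at hmean
  have hint : (∫ θ in Set.Ioc 0 (2 * Real.pi), g (circleMap 0 1 θ • z) ^ 2) =
      (2 * Real.pi) • g 0 ^ 2 := by
    rw [← hmean, smul_smul, mul_inv_cancel₀ Real.two_pi_pos.ne', one_smul]
  calc ‖g 0‖ₑ ^ 2 * ENNReal.ofReal (2 * Real.pi)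
      = ‖∫ θ in Set.Ioc 0 (2 * Real.pi), g (circleMap 0 1 θ • z) ^ 2‖ₑ := by
        rw [hint, enorm_smul, enorm_pow, Real.enorm_of_nonneg Real.two_pi_pos.le, mul_comm]
    _ ≤ _ := by
        refine (enorm_integral_le_lintegral_enorm _).trans_eq (lintegral_congr fun θ => ?_)
        exact enorm_pow _ _

/-- Multiplication by a unimodular scalar preserves the volume of `ℂᵏ`. -/
theorem measurePreserving_circleMap_smul {ι : Type*} [Fintype ι] (θ : ℝ) :
    MeasurePreserving (fun z : ι → ℂ => circleMap 0 1 θ • z) := by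
  have h1 : MeasurePreserving (fun z : ℂ => circleMap 0 1 θ * z) := by
    convert (rotation (Circle.exp θ)).measurePreserving using 1
    ext z
    simp [circleMap]
  exact volume_preserving_pi fun _ => h1

theorem integrable_exp_neg_pi_normSq_complex :
    Integrable fun z : ℂ => Real.exp (-Real.pi * Complex.normSq z) := by
  refine Integrable.of_integral_ne_zero ?_
  simp_rw [Complex.normSq_eq_norm_sq]
  rw [GaussianFourier.integral_rexp_neg_mul_sq_norm Real.pi_pos]
  simp [Real.pi_ne_zero]

theorem exp_neg_pi_sum_normSq {ι : Type*} [Fintype ι] (z : ι → ℂ) :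
    Real.exp (-Real.pi * ∑ i, Complex.normSq (z i)) =
      ∏ i, Real.exp (-Real.pi * Complex.normSq (z i)) := by
  rw [Finset.mul_sum, Real.exp_sum]

theorem integrable_exp_neg_pi_sum_normSq (ι : Type*) [Fintype ι] :
    Integrable fun z : ι → ℂ => Real.exp (-Real.pi * ∑ i, Complex.normSq (z i)) := by
  simp_rw [exp_neg_pi_sum_normSq]
  exact Integrable.fintype_prod fun _ => integrable_exp_neg_pi_normSq_complex

theorem integral_exp_neg_pi_sum_normSq (ι : Type*) [Fintype ι] :
    ∫ z : ι → ℂ, Real.exp (-Real.pi * ∑ i, Complex.normSq (z i)) = 1 := by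
  simp_rw [exp_neg_pi_sum_normSq]
  rw [integral_fintype_prod_volume_eq_pow fun z : ℂ => Real.exp (-Real.pi * Complex.normSq z)]
  simp_rw [Complex.normSq_eq_norm_sq]
  rw [GaussianFourier.integral_rexp_neg_mul_sq_norm Real.pi_pos]
  simp [Real.pi_ne_zero]

theorem lintegral_exp_neg_pi_sum_normSq (ι : Type*) [Fintype ι] :
    ∫⁻ z : ι → ℂ, ENNReal.ofReal (Real.exp (-Real.pi * ∑ i, Complex.normSq (z i))) = 1 := by
  rw [← ofReal_integral_eq_lintegral_ofReal (integrable_exp_neg_pi_sum_normSq ι)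
    (.of_forall fun _ => (Real.exp_pos _).le), integral_exp_neg_pi_sum_normSq, ENNReal.ofReal_one]

/-- Evaluation at the origin is a contraction on the Fock space. -/
theorem enorm_sq_zero_le_lintegral_fock {ι : Type*} [Fintype ι] {g : (ι → ℂ) → ℂ}
    (hg : Differentiable ℂ g) :
    ‖g 0‖ₑ ^ 2 ≤ ∫⁻ z : ι → ℂ,
      ‖g z‖ₑ ^ 2 * ENNReal.ofReal (Real.exp (-Real.pi * ∑ i, Complex.normSq (z i))) := by
  set w : (ι → ℂ) → ENNReal :=
    fun z => ENNReal.ofReal (Real.exp (-Real.pi * ∑ i, Complex.normSq (z i))) with hw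
  have hgc : Continuous g := hg.continuous
  have hwc : Measurable w := by
    have : Continuous fun z : ι → ℂ => Real.exp (-Real.pi * ∑ i, Complex.normSq (z i)) := by
      have := Complex.continuous_normSq
      fun_prop
    exact this.measurable.ennreal_ofReal
  have hwrot (θ : ℝ) (z : ι → ℂ) : w (circleMap 0 1 θ • z) = w z := by
    simp [hw, Complex.normSq_eq_norm_sq]
  have hrot (θ : ℝ) : ∫⁻ z, ‖g (circleMap 0 1 θ • z)‖ₑ ^ 2 * w z = ∫⁻ z, ‖g z‖ₑ ^ 2 * w z := by
    have hm : Measurable fun z => ‖g z‖ₑ ^ 2 * w z := (hgc.measurable.enorm.pow_const 2).mul hwc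
    rw [← (measurePreserving_circleMap_smul (ι := ι) θ).lintegral_comp hm]
    simp_rw [hwrot]
  have h2pi : ENNReal.ofReal (2 * Real.pi) ≠ 0 := by simp [Real.pi_pos]
  refine (ENNReal.mul_le_mul_iff_left h2pi ENNReal.ofReal_ne_top).1 ?_
  calc ‖g 0‖ₑ ^ 2 * ENNReal.ofReal (2 * Real.pi)
      = ∫⁻ z, (‖g 0‖ₑ ^ 2 * ENNReal.ofReal (2 * Real.pi)) * w z := by
        rw [lintegral_const_mul _ hwc, lintegral_exp_neg_pi_sum_normSq, mul_one]
    _ ≤ ∫⁻ z, (∫⁻ θ in Set.Ioc 0 (2 * Real.pi), ‖g (circleMap 0 1 θ • z)‖ₑ ^ 2) * w z :=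
        lintegral_mono fun z =>
          mul_le_mul_left (enorm_sq_mul_two_pi_le_lintegral_rotation hg z) (w z)
    _ = ∫⁻ z, ∫⁻ θ in Set.Ioc 0 (2 * Real.pi), ‖g (circleMap 0 1 θ • z)‖ₑ ^ 2 * w z := by
        refine lintegral_congr fun z => (lintegral_mul_const _ ?_).symm
        have : Continuous fun θ : ℝ => g (circleMap 0 1 θ • z) := by fun_prop
        exact this.measurable.enorm.pow_const 2
    _ = ∫⁻ θ in Set.Ioc 0 (2 * Real.pi), ∫⁻ z, ‖g (circleMap 0 1 θ • z)‖ₑ ^ 2 * w z := by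
        refine lintegral_lintegral_swap (Measurable.aemeasurable ?_)
        have : Continuous fun p : (ι → ℂ) × ℝ => g (circleMap 0 1 p.2 • p.1) := by
          have := continuous_circleMap 0 1
          fun_prop
        exact (this.measurable.enorm.pow_const 2).mul (hwc.comp measurable_fst)
    _ = (∫⁻ z, ‖g z‖ₑ ^ 2 * w z) * ENNReal.ofReal (2 * Real.pi) := by
        simp_rw [hrot]
        simp

theorem norm_sq_zero_le_integral_fock {ι : Type*} [Fintype ι] {g : (ι → ℂ) → ℂ}
    (hg : Differentiable ℂ g)
    (hgL2 : Integrable fun z : ι → ℂ =>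
      ‖g z‖ ^ 2 * Real.exp (-Real.pi * ∑ i, Complex.normSq (z i))) :
    ‖g 0‖ ^ 2 ≤
      ∫ z : ι → ℂ, ‖g z‖ ^ 2 * Real.exp (-Real.pi * ∑ i, Complex.normSq (z i)) := by
  have h0 (z : ι → ℂ) : 0 ≤ ‖g z‖ ^ 2 * Real.exp (-Real.pi * ∑ i, Complex.normSq (z i)) := by
    positivity
  rw [← ENNReal.ofReal_le_ofReal_iff (integral_nonneg h0),
    ofReal_integral_eq_lintegral_ofReal hgL2 (.of_forall h0)]
  simpa [ENNReal.ofReal_mul, ENNReal.ofReal_pow] using enorm_sq_zero_le_lintegral_fock hg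

theorem measurePreserving_finAppend (m k : ℕ) :
    MeasurePreserving (Fin.appendHomeomorph (X := ℂ) m k).toMeasurableEquiv := by
  have h := (volume_measurePreserving_piCongrLeft (fun _ : Fin (m + k) => ℂ)
    (finSumFinEquiv (m := m) (n := k))).comp
    (volume_measurePreserving_sumPiEquivProdPi_symm fun _ : Fin m ⊕ Fin k => ℂ)
  have heq : ⇑(Fin.appendHomeomorph (X := ℂ) m k).toMeasurableEquiv =
      MeasurableEquiv.piCongrLeft (fun _ : Fin (m + k) => ℂ) finSumFinEquiv ∘
        (MeasurableEquiv.sumPiEquivProdPi fun _ : Fin m ⊕ Fin k => ℂ).symm := by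
    funext p i
    have hcongr := Equiv.piCongrLeft_apply_apply (fun _ : Fin (m + k) => ℂ) finSumFinEquiv
      ((MeasurableEquiv.sumPiEquivProdPi fun _ : Fin m ⊕ Fin k => ℂ).symm p)
    induction i using Fin.addCases with
    | left i => exact (Fin.append_left p.1 p.2 i).trans (hcongr (.inl i)).symm
    | right i => exact (Fin.append_right p.1 p.2 i).trans (hcongr (.inr i)).symm
  rw [heq]
  exact h

theorem exp_neg_pi_sum_normSq_append {m k : ℕ} (x : Fin m → ℂ) (y : Fin k → ℂ) :
    Real.exp (-Real.pi * ∑ i, Complex.normSq (Fin.append x y i)) =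
      Real.exp (-Real.pi * ∑ i, Complex.normSq (x i)) *
        Real.exp (-Real.pi * ∑ i, Complex.normSq (y i)) := by
  rw [Fin.sum_univ_add, mul_add, Real.exp_add]
  simp

theorem differentiable_finAppend_right {m k : ℕ} (x : Fin m → ℂ) :
    Differentiable ℂ fun y : Fin k → ℂ => Fin.append x y := by
  refine differentiable_pi.2 fun i => ?_
  induction i using Fin.addCases with
  | left i => simp
  | right i =>
    simp only [Fin.append_right]
    fun_prop

/-- Minimal holomorphic extension in the Fock–Bargmann space.
Let `f : ℂᵐ → ℂ` be holomorphic with `∫_{ℂᵐ} |f|² e^{-π|z|²} < ∞`.  The extension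
`F(z₁,…,zₙ) := f(z₁,…,zₘ)` of `f` to `ℂⁿ` satisfies
`∫_{ℂⁿ} |F|² e^{-π|z|²} = ∫_{ℂᵐ} |f|² e^{-π|z|²}`, and it is of minimal weighted
`L²`-norm among all holomorphic extensions `G` of `f` with finite weighted `L²`-norm. -/
theorem fock_minimal_extension (n m : ℕ) (h : m ≤ n) (f : (Fin m → ℂ) → ℂ)
    (hf : Differentiable ℂ f)
    (hfL2 : Integrable (fun z : Fin m → ℂ =>
      ‖f z‖ ^ 2 * Real.exp (-Real.pi * ∑ i, Complex.normSq (z i)))) :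
    ((∫ z : Fin n → ℂ,
        ‖f (fun j => z (Fin.castLE h j))‖ ^ 2
          * Real.exp (-Real.pi * ∑ i, Complex.normSq (z i)))
      = ∫ z : Fin m → ℂ, ‖f z‖ ^ 2 * Real.exp (-Real.pi * ∑ i, Complex.normSq (z i))) ∧
    (∀ G : (Fin n → ℂ) → ℂ, Differentiable ℂ G →
      Integrable (fun z : Fin n → ℂ =>
        ‖G z‖ ^ 2 * Real.exp (-Real.pi * ∑ i, Complex.normSq (z i))) →
      (∀ w : Fin m → ℂ, G (fun i => if hi : (i : ℕ) < m then w ⟨i, hi⟩ else 0) = f w) →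
      (∫ z : Fin n → ℂ,
          ‖f (fun j => z (Fin.castLE h j))‖ ^ 2
            * Real.exp (-Real.pi * ∑ i, Complex.normSq (z i)))
        ≤ ∫ z : Fin n → ℂ,
            ‖G z‖ ^ 2 * Real.exp (-Real.pi * ∑ i, Complex.normSq (z i))) := by
  obtain ⟨k, rfl⟩ := Nat.exists_eq_add_of_le h
  have happ := measurePreserving_finAppend m k
  have hemb := (Fin.appendHomeomorph (X := ℂ) m k).toMeasurableEquiv.measurableEmbedding
  have hcoe (p : (Fin m → ℂ) × (Fin k → ℂ)) :
      (Fin.appendHomeomorph (X := ℂ) m k).toMeasurableEquiv p = Fin.append p.1 p.2 := rfl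
  have hnorm : (∫ z : Fin (m + k) → ℂ,
        ‖f (fun j => z (Fin.castLE h j))‖ ^ 2
          * Real.exp (-Real.pi * ∑ i, Complex.normSq (z i)))
      = ∫ z : Fin m → ℂ, ‖f z‖ ^ 2 * Real.exp (-Real.pi * ∑ i, Complex.normSq (z i)) := by
    have hres (p : (Fin m → ℂ) × (Fin k → ℂ)) :
        (fun j => Fin.append p.1 p.2 (Fin.castLE h j)) = p.1 :=
      funext fun j => Fin.append_left p.1 p.2 j
    rw [← happ.integral_comp hemb]
    simp_rw [hcoe, exp_neg_pi_sum_normSq_append, hres, ← mul_assoc]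
    rw [Measure.volume_eq_prod, integral_prod_mul
      (fun x : Fin m → ℂ => ‖f x‖ ^ 2 * Real.exp (-Real.pi * ∑ i, Complex.normSq (x i)))
      (fun y : Fin k → ℂ => Real.exp (-Real.pi * ∑ i, Complex.normSq (y i))),
      integral_exp_neg_pi_sum_normSq, mul_one]
  refine ⟨hnorm, fun G hG hGL2 hGf => ?_⟩
  have hGf' (x : Fin m → ℂ) : G (Fin.append x 0) = f x := by
    rw [← hGf x]
    congr 1
    ext i
    induction i using Fin.addCases <;> simp
  rw [hnorm, ← happ.integral_comp hemb]
  rw [← happ.integrable_comp_emb hemb] at hGL2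
  simp only [Function.comp_def, hcoe, exp_neg_pi_sum_normSq_append] at hGL2 ⊢
  rw [Measure.volume_eq_prod] at hGL2 ⊢
  rw [integral_prod _ hGL2]
  refine integral_mono_ae hfL2 hGL2.integral_prod_left ?_
  filter_upwards [hGL2.prod_right_ae] with x hx
  simp_rw [mul_left_comm _ (Real.exp (-Real.pi * ∑ i, Complex.normSq (x i)))] at hx ⊢
  rw [integrable_const_mul_iff (Real.exp_pos _).ne'.isUnit] at hx
  rw [integral_const_mul, mul_comm]
  refine mul_le_mul_of_nonneg_left ?_ (Real.exp_pos _).le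
  rw [← hGf' x]
  exact norm_sq_zero_le_integral_fock (hG.comp (differentiable_finAppend_right x)) hx
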